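/- For the linearly oriented A_n quiver Q: 1 → 2 → ⋯ → n, let σ be a totally stable stability condition on D^b(kQ) normalized so that Z(S₁) = 1. Define P₀ = 0 and P_j = Z(M_{1j}) ∈ ℂ = ℝ² for 1 ≤ j ≤ n, where M_{ij} is the indecomposable representation supported on vertices i through j. Then P₀, P₁, …, P_n are the vertices, in anticlockwise order, of a convex (n+1)-gon, and Z(M_{ij}) is the vector from P_{i−1} to P_j. -/

import Mathlib

open CategoryTheory CategoryTheory.Limits CategoryTheory.Pretriangulated

universe v u

variable (C : Type u) [Category.{v} C] [Preadditive C] [HasZeroObject C]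
  [HasShift C ℤ] [∀ n : ℤ, (shiftFunctor C n).Additive] [Pretriangulated C]
  [HasFiniteBiproducts C]

/-- A Bridgeland stability condition, encoded by a central charge on objects and a slicing. -/
structure StabilityCondition where
  Z : C → ℂ
  P : ℝ → Set C
  mem_of_iso : ∀ {φ : ℝ} {E F : C}, (E ≅ F) → E ∈ P φ → F ∈ P φ
  charge : ∀ {φ : ℝ} {E : C}, E ∈ P φ → ¬ IsZero E →
    ∃ m : ℝ, 0 < m ∧ Z E = (m : ℂ) * Complex.exp (Real.pi * φ * Complex.I)
  shift_mem : ∀ (φ : ℝ) (E : C), E ∈ P φ ↔ E⟦(1 : ℤ)⟧ ∈ P (φ + 1)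
  sum_mem : ∀ {φ : ℝ} {X Y : C}, X ∈ P φ → Y ∈ P φ → (X ⊞ Y) ∈ P φ
  summand_mem : ∀ {φ : ℝ} {X Y : C}, (X ⊞ Y) ∈ P φ → X ∈ P φ
  hom_zero : ∀ {φ₁ φ₂ : ℝ}, φ₂ < φ₁ → ∀ {E F : C}, E ∈ P φ₁ → F ∈ P φ₂ →
    ∀ f : E ⟶ F, f = 0
  HN : ∀ E : C, ¬ IsZero E → ∃ (n : ℕ) (obj : Fin (n + 1) → C) (φ : Fin n → ℝ),
    IsZero (obj 0) ∧ Nonempty (obj (Fin.last n) ≅ E) ∧ StrictAnti φ ∧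
    ∀ i : Fin n, ∃ (A : C) (f : obj i.castSucc ⟶ obj i.succ) (g : obj i.succ ⟶ A)
      (h : A ⟶ (obj i.castSucc)⟦(1 : ℤ)⟧),
      (Triangle.mk f g h ∈ distTriang C) ∧ A ∈ P (φ i) ∧ ¬ IsZero A

variable {C}

/-- `E` is semistable iff it lies in some slice. -/
def StabilityCondition.IsSemistable (σ : StabilityCondition C) (E : C) : Prop :=
  ∃ φ : ℝ, E ∈ σ.P φ

/-- The global dimension of a stability condition. -/
noncomputable def StabilityCondition.gldim (σ : StabilityCondition C) : EReal :=
  sSup {d : EReal | ∃ (φ₁ φ₂ : ℝ) (E F : C) (f : E ⟶ F),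
    E ∈ σ.P φ₁ ∧ F ∈ σ.P φ₂ ∧ f ≠ 0 ∧ d = ((φ₂ - φ₁ : ℝ) : EReal)}

/-- An object is indecomposable if it is nonzero and any biproduct decomposition is trivial. -/
def IsIndec (E : C) : Prop :=
  ¬ IsZero E ∧ ∀ (X Y : C), (E ≅ X ⊞ Y) → IsZero X ∨ IsZero Y

/-- `E` is stable of phase `φ`: it is a nonzero object of `P(φ)` admitting no nontrivial
extension decomposition inside `P(φ)` (i.e. it is simple in the abelian category `P(φ)`). -/
def StabilityCondition.IsStableOfPhase (σ : StabilityCondition C) (E : C) (φ : ℝ) : Prop :=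
  E ∈ σ.P φ ∧ ¬ IsZero E ∧ ∀ (A B : C) (f : A ⟶ E) (g : E ⟶ B) (h : B ⟶ A⟦(1 : ℤ)⟧),
    (Triangle.mk f g h ∈ distTriang C) → A ∈ σ.P φ → B ∈ σ.P φ →
    ¬ IsZero A → ¬ IsZero B → False

/-- The Krull–Schmidt property: every nonzero object is a finite biproduct of indecomposables. -/
def KrullSchmidt : Prop :=
  ∀ X : C, ¬ IsZero X → ∃ (m : ℕ) (f : Fin m → C),
    (∀ i, IsIndec (f i)) ∧ Nonempty (X ≅ ⨁ f)

/-- Cross product of plane vectors (identifying `ℂ = ℝ²`). -/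
def cross2 (u v : ℂ) : ℝ := u.re * v.im - u.im * v.re

/-- `P 0, …, P n` are the vertices, listed in anticlockwise order, of a convex
`(n+1)`-gon: every other vertex lies strictly to the left of each directed edge. -/
def ConvexGonCCW (P : ℕ → ℂ) (n : ℕ) : Prop :=
  ∀ a b : ℕ, a ≤ n → b ≤ n → b ≠ a → b ≠ (a + 1) % (n + 1) →
    0 < cross2 (P ((a + 1) % (n + 1)) - P a) (P b - P a)

/-- The vertex `P j = Z(M_{1j}) = Z(S₁) + ⋯ + Z(S_j)` (and `P 0 = 0`). -/
noncomputable def vertexPt (σ : StabilityCondition C) (M : ℕ → ℕ → C) (j : ℕ) : ℂ :=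
  ∑ k ∈ Finset.Icc 1 j, σ.Z (M k k)

/-- The structure of the bounded derived category of the linearly oriented `A_n` quiver:
the objects `M i j` (for `1 ≤ i ≤ j ≤ n`) are the interval modules; together with their
shifts they are exactly the indecomposables, and morphisms between them (in each shift
degree) are as in `D^b(k A_n)`, with `τ(M_{ij}) = M_{i-1,j-1}` governing degree-one maps. -/
structure TypeAData (n : ℕ) (M : ℕ → ℕ → C) : Prop where
  indec : ∀ i j : ℕ, 1 ≤ i → i ≤ j → j ≤ n → ∀ m : ℤ, IsIndec ((M i j)⟦m⟧)
  indec_iff : ∀ E : C, IsIndec E ↔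
    ∃ (i j : ℕ) (m : ℤ), 1 ≤ i ∧ i ≤ j ∧ j ≤ n ∧ Nonempty (E ≅ (M i j)⟦m⟧)
  hom0 : ∀ i j k l : ℕ, 1 ≤ i → i ≤ j → j ≤ n → 1 ≤ k → k ≤ l → l ≤ n →
    ((∃ f : M i j ⟶ M k l, f ≠ 0) ↔ (i ≤ k ∧ k ≤ j ∧ j ≤ l))
  hom1 : ∀ i j k l : ℕ, 1 ≤ i → i ≤ j → j ≤ n → 1 ≤ k → k ≤ l → l ≤ n →
    ((∃ f : M i j ⟶ (M k l)⟦(1 : ℤ)⟧, f ≠ 0) ↔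
      (2 ≤ i ∧ k ≤ i - 1 ∧ i - 1 ≤ l ∧ l ≤ j - 1))
  hom_other : ∀ i j k l : ℕ, 1 ≤ i → i ≤ j → j ≤ n → 1 ≤ k → k ≤ l → l ≤ n →
    ∀ m : ℤ, m ≠ 0 → m ≠ 1 → ∀ f : M i j ⟶ (M k l)⟦m⟧, f = 0

/-- If an indecomposable object has a nonzero retract, the retract is the whole object. -/
lemma IsIndec.isIso_retract {E X : C} (hE : IsIndec E) (hX : ¬ IsZero X) (R : Retract X E) :
    IsIso R.i := by
  obtain ⟨Y, g, h, hT⟩ := distinguished_cocone_triangle R.i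
  have h0 : h = 0 := by
    have h1 : h ≫ R.i⟦(1 : ℤ)⟧' = 0 := comp_distTriang_mor_zero₃₁ _ hT
    have h2 : (h ≫ R.i⟦(1 : ℤ)⟧') ≫ R.r⟦(1 : ℤ)⟧' = h := by
      rw [Category.assoc, ← Functor.map_comp, R.retract, CategoryTheory.Functor.map_id, Category.comp_id]
    rw [← h2, h1, zero_comp]
  obtain ⟨e, -, -⟩ := exists_iso_binaryBiproduct_of_distTriang _ hT h0
  exact (Triangle.isZero₃_iff_isIso₁ _ hT).1 ((hE.2 _ _ e).resolve_left hX)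

section Cone

variable {E F K X : C} {f : E ⟶ F} {g : F ⟶ K} {h : K ⟶ E⟦(1 : ℤ)⟧}

/-- A nonzero retract of the cone of a nonzero morphism receives a nonzero morphism from the
target, provided the shifted source is indecomposable. -/
lemma comp_retract_r_ne_zero (hT : Triangle.mk f g h ∈ distTriang C) (hf : f ≠ 0)
    (hE : IsIndec (E⟦(1 : ℤ)⟧)) (hX : ¬ IsZero X) (R : Retract X K) : g ≫ R.r ≠ 0 := by
  intro h0
  obtain ⟨t, ht⟩ : ∃ t : E⟦(1 : ℤ)⟧ ⟶ X, R.r = h ≫ t := Triangle.yoneda_exact₃ _ hT R.r h0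
  have : IsIso (R.i ≫ h) := hE.isIso_retract hX
    ⟨R.i ≫ h, t, by rw [Category.assoc, ← ht, R.retract]⟩
  have h1 : h ≫ f⟦(1 : ℤ)⟧' = 0 := comp_distTriang_mor_zero₃₁ _ hT
  have h2 : (R.i ≫ h) ≫ f⟦(1 : ℤ)⟧' = 0 := by rw [Category.assoc, h1, comp_zero]
  exact hf ((Functor.map_eq_zero_iff _).1 ((cancel_epi (R.i ≫ h)).1 (h2.trans comp_zero.symm)))

/-- A nonzero retract of the cone of a nonzero morphism maps nontrivially to the shifted source,
provided the target is indecomposable. -/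
lemma retract_i_comp_ne_zero (hT : Triangle.mk f g h ∈ distTriang C) (hf : f ≠ 0)
    (hF : IsIndec F) (hX : ¬ IsZero X) (R : Retract X K) : R.i ≫ h ≠ 0 := by
  intro h0
  obtain ⟨t, ht⟩ : ∃ t : X ⟶ F, R.i = t ≫ g := Triangle.coyoneda_exact₃ _ hT R.i h0
  have h3 : t ≫ g ≫ R.r = 𝟙 X := by rw [← Category.assoc, ← ht, R.retract]
  have : IsIso t := hF.isIso_retract hX ⟨t, g ≫ R.r, h3⟩
  have h4 : g ≫ R.r = inv t := by rw [← cancel_epi t, h3, IsIso.hom_inv_id]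
  have h1 : f ≫ g = 0 := comp_distTriang_mor_zero₁₂ _ hT
  have h2 : f ≫ inv t = 0 := by rw [← h4, ← Category.assoc, h1, zero_comp]
  exact hf ((cancel_mono (inv t)).1 (h2.trans zero_comp.symm))

lemma exists_ne_zero_of_to_retract {T : C} (hT : Triangle.mk f g h ∈ distTriang C)
    (R : Retract X K) (u : T ⟶ X) (hu : u ≠ 0) :
    (∃ v : T ⟶ F, v ≠ 0) ∨ (∃ v : T ⟶ E⟦(1 : ℤ)⟧, v ≠ 0) := by
  by_contra! hc
  obtain ⟨t, ht⟩ : ∃ t : T ⟶ F, u ≫ R.i = t ≫ g :=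
    Triangle.coyoneda_exact₃ _ hT (u ≫ R.i) (hc.2 _)
  apply hu
  have h1 : (u ≫ R.i) ≫ R.r = u := by rw [Category.assoc, R.retract, Category.comp_id]
  rw [← h1, ht, hc.1 t, zero_comp, zero_comp]

lemma exists_ne_zero_of_from_retract {T : C} (hT : Triangle.mk f g h ∈ distTriang C)
    (R : Retract X K) (u : X ⟶ T) (hu : u ≠ 0) :
    (∃ v : F ⟶ T, v ≠ 0) ∨ (∃ v : E⟦(1 : ℤ)⟧ ⟶ T, v ≠ 0) := by
  by_contra! hc
  obtain ⟨t, ht⟩ : ∃ t : E⟦(1 : ℤ)⟧ ⟶ T, R.r ≫ u = h ≫ t :=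
    Triangle.yoneda_exact₃ _ hT (R.r ≫ u) (hc.1 _)
  apply hu
  have h1 : R.i ≫ R.r ≫ u = u := by rw [← Category.assoc, R.retract, Category.id_comp]
  rw [← h1, ht, hc.2 t, comp_zero, comp_zero]

end Cone

lemma exists_shift_hom_ne_zero_iff {A B : C} :
    (∃ u : A⟦(1 : ℤ)⟧ ⟶ B⟦(1 : ℤ)⟧, u ≠ 0) ↔ ∃ u : A ⟶ B, u ≠ 0 := by
  constructor
  · rintro ⟨u, hu⟩
    obtain ⟨v, rfl⟩ := (shiftFunctor C (1 : ℤ)).map_surjective u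
    exact ⟨v, fun hv => hu (by rw [hv, Functor.map_zero])⟩
  · rintro ⟨u, hu⟩
    exact ⟨u⟦(1 : ℤ)⟧', fun hv => hu ((Functor.map_eq_zero_iff _).1 hv)⟩

/-- The combinatorial condition for a nonzero morphism `M i j ⟶ M k l`. -/
def IntervalHom (i j k l : ℕ) : Prop := i ≤ k ∧ k ≤ j ∧ j ≤ l

/-- The combinatorial condition for a nonzero morphism `M i j ⟶ (M k l)⟦1⟧`. -/
def IntervalExt (i j k l : ℕ) : Prop := 2 ≤ i ∧ k ≤ i - 1 ∧ i - 1 ≤ l ∧ l ≤ j - 1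

/-- The condition for `M i j` to be one of the interval modules of the `A_n` quiver. -/
def IsInterval (n i j : ℕ) : Prop := 1 ≤ i ∧ i ≤ j ∧ j ≤ n

namespace TypeAData

variable {n : ℕ} {M : ℕ → ℕ → C}

lemma exists_hom_iff (hM : TypeAData (C := C) n M) {i j k l : ℕ} (hij : IsInterval n i j)
    (hkl : IsInterval n k l) : (∃ u : M i j ⟶ M k l, u ≠ 0) ↔ IntervalHom i j k l :=
  hM.hom0 i j k l hij.1 hij.2.1 hij.2.2 hkl.1 hkl.2.1 hkl.2.2

lemma exists_ext_iff (hM : TypeAData (C := C) n M) {i j k l : ℕ} (hij : IsInterval n i j)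
    (hkl : IsInterval n k l) :
    (∃ u : M i j ⟶ (M k l)⟦(1 : ℤ)⟧, u ≠ 0) ↔ IntervalExt i j k l :=
  hM.hom1 i j k l hij.1 hij.2.1 hij.2.2 hkl.1 hkl.2.1 hkl.2.2

lemma isIndec (hM : TypeAData (C := C) n M) {i j : ℕ} (hij : IsInterval n i j) :
    IsIndec (M i j) :=
  (hM.indec_iff _).2 ⟨i, j, 0, hij.1, hij.2.1, hij.2.2,
    ⟨((shiftFunctorZero C ℤ).app (M i j)).symm⟩⟩

lemma shift_hom_eq_zero (hM : TypeAData (C := C) n M) {i j k l : ℕ} (hij : IsInterval n i j)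
    (hkl : IsInterval n k l) (u : (M i j)⟦(1 : ℤ)⟧ ⟶ M k l) : u = 0 := by
  obtain ⟨v, hv⟩ := (shiftFunctor C (1 : ℤ)).map_surjective
    (u ≫ (shiftNegShift (M k l) (1 : ℤ)).inv)
  have hv0 : v = 0 := hM.hom_other i j k l hij.1 hij.2.1 hij.2.2 hkl.1 hkl.2.1 hkl.2.2 (-1)
    (by norm_num) (by norm_num) v
  rw [hv0, Functor.map_zero] at hv
  rw [← cancel_mono (shiftNegShift (M k l) (1 : ℤ)).inv, ← hv, zero_comp]

/-- Constraints on the indecomposable summands of the cone of a nonzero morphism between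
interval modules. -/
lemma cone_retract (hM : TypeAData (C := C) n M) {i j p q a b : ℕ} {m : ℤ}
    (hij : IsInterval n i j) (hpq : IsInterval n p q) (hab : IsInterval n a b)
    {K : C} {f : M i j ⟶ M p q} {g : M p q ⟶ K} {h : K ⟶ (M i j)⟦(1 : ℤ)⟧}
    (hT : Triangle.mk f g h ∈ distTriang C) (hf : f ≠ 0) (R : Retract ((M a b)⟦m⟧) K) :
    (m = 0 ∧ IntervalHom p q a b ∧ IntervalExt a b i j ∧
      (∀ c d, IsInterval n c d → IntervalHom a b c d → IntervalHom p q c d) ∧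
      (∀ c d, IsInterval n c d → IntervalHom c d a b →
        IntervalHom c d p q ∨ IntervalExt c d i j)) ∨
    (m = 1 ∧ IntervalExt p q a b ∧ IntervalHom a b i j ∧
      (∀ c d, IsInterval n c d → IntervalHom a b c d →
        IntervalExt p q c d ∨ IntervalHom i j c d) ∧
      (∀ c d, IsInterval n c d → IntervalHom c d a b → IntervalHom c d i j)) := by
  have hE := hM.indec i j hij.1 hij.2.1 hij.2.2 1
  have hF := hM.isIndec hpq
  have hX := (hM.indec a b hab.1 hab.2.1 hab.2.2 m).1
  have h1 := comp_retract_r_ne_zero hT hf hE hX R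
  by_cases hm0 : m = 0
  · left
    subst hm0
    let R' : Retract (M a b) K :=
      (Retract.ofIso ((shiftFunctorZero C ℤ).app (M a b)).symm).trans R
    have hX' := (hM.isIndec hab).1
    refine ⟨rfl, (hM.exists_hom_iff hpq hab).1 ⟨_, comp_retract_r_ne_zero hT hf hE hX' R'⟩,
      (hM.exists_ext_iff hab hij).1 ⟨_, retract_i_comp_ne_zero hT hf hF hX' R'⟩, ?_, ?_⟩
    · intro c d hcd hh
      obtain ⟨u, hu⟩ := (hM.exists_hom_iff hab hcd).2 hh
      rcases exists_ne_zero_of_from_retract hT R' u hu with hv | ⟨v, hv⟩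
      · exact (hM.exists_hom_iff hpq hcd).1 hv
      · exact absurd (hM.shift_hom_eq_zero hij hcd v) hv
    · intro c d hcd hh
      obtain ⟨u, hu⟩ := (hM.exists_hom_iff hcd hab).2 hh
      exact (exists_ne_zero_of_to_retract hT R' u hu).imp
        (hM.exists_hom_iff hcd hpq).1 (hM.exists_ext_iff hcd hij).1
  · by_cases hm1 : m = 1
    · right
      subst hm1
      refine ⟨rfl, (hM.exists_ext_iff hpq hab).1 ⟨_, h1⟩, (hM.exists_hom_iff hab hij).1
        (exists_shift_hom_ne_zero_iff.1 ⟨_, retract_i_comp_ne_zero hT hf hF hX R⟩), ?_, ?_⟩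
      · intro c d hcd hh
        obtain ⟨u, hu⟩ := exists_shift_hom_ne_zero_iff.2 ((hM.exists_hom_iff hab hcd).2 hh)
        exact (exists_ne_zero_of_from_retract hT R u hu).imp (hM.exists_ext_iff hpq hcd).1
          (fun hv => (hM.exists_hom_iff hij hcd).1 (exists_shift_hom_ne_zero_iff.1 hv))
      · intro c d hcd hh
        obtain ⟨u, hu⟩ := exists_shift_hom_ne_zero_iff.2 ((hM.exists_hom_iff hcd hab).2 hh)
        rcases exists_ne_zero_of_to_retract hT R u hu with ⟨v, hv⟩ | hv
        · exact absurd (hM.shift_hom_eq_zero hcd hpq v) hv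
        · exact (hM.exists_hom_iff hcd hij).1 (exists_shift_hom_ne_zero_iff.1 hv)
    · exact absurd (hM.hom_other p q a b hpq.1 hpq.2.1 hpq.2.2 hab.1 hab.2.1 hab.2.2 m hm0 hm1 _)
        h1

/-- Every summand of the cone of a nonzero morphism `M i j ⟶ M i l` is `M (j + 1) l`. -/
lemma cone_retract_inclusion (hM : TypeAData (C := C) n M) {i j l a b : ℕ} {m : ℤ}
    (hi : 1 ≤ i) (hij : i ≤ j) (hjl : j < l) (hl : l ≤ n) (hab : IsInterval n a b)
    {K : C} {f : M i j ⟶ M i l} {g : M i l ⟶ K} {h : K ⟶ (M i j)⟦(1 : ℤ)⟧}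
    (hT : Triangle.mk f g h ∈ distTriang C) (hf : f ≠ 0) (R : Retract ((M a b)⟦m⟧) K) :
    a = j + 1 ∧ b = l ∧ m = 0 := by
  have := hM.cone_retract (by unfold IsInterval; omega) (by unfold IsInterval; omega) hab hT hf R
  unfold IntervalHom IntervalExt IsInterval at this
  unfold IsInterval at hab
  rcases this with ⟨hm, h1, h2, h3, h4⟩ | ⟨hm, h1, h2, h3, h4⟩
  · have := h3 b b (by omega) (by omega)
    have := h4 a a (by omega) (by omega)
    omega
  · have := h4 a a (by omega) (by omega)
    omega

/-- Every summand of the cone of a nonzero morphism `M i l ⟶ M (j + 1) l` is `(M i j)⟦1⟧`. -/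
lemma cone_retract_projection (hM : TypeAData (C := C) n M) {i j l a b : ℕ} {m : ℤ}
    (hi : 1 ≤ i) (hij : i ≤ j) (hjl : j < l) (hl : l ≤ n) (hab : IsInterval n a b)
    {K : C} {f : M i l ⟶ M (j + 1) l} {g : M (j + 1) l ⟶ K} {h : K ⟶ (M i l)⟦(1 : ℤ)⟧}
    (hT : Triangle.mk f g h ∈ distTriang C) (hf : f ≠ 0) (R : Retract ((M a b)⟦m⟧) K) :
    a = i ∧ b = j ∧ m = 1 := by
  have := hM.cone_retract (by unfold IsInterval; omega) (by unfold IsInterval; omega) hab hT hf R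
  unfold IntervalHom IntervalExt IsInterval at this
  unfold IsInterval at hab
  rcases this with ⟨hm, h1, h2, h3, h4⟩ | ⟨hm, h1, h2, h3, h4⟩
  · have := h3 b b (by omega) (by omega)
    omega
  · have := h3 b b (by omega) (by omega)
    have := h4 a a (by omega) (by omega)
    omega

lemma not_isIso (hM : TypeAData (C := C) n M) {i j k l : ℕ} (hij : IsInterval n i j)
    (hkl : IsInterval n k l) (hne : i ≠ k ∨ j ≠ l) (f : M i j ⟶ M k l) : ¬ IsIso f := by
  intro hf
  have h1 : f ≠ 0 := fun h0 => (hM.isIndec hij).1 <| by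
    rw [IsZero.iff_id_eq_zero, ← IsIso.hom_inv_id f]
    exact (congrArg (· ≫ inv f) h0).trans zero_comp
  have h2 : inv f ≠ 0 := fun h0 => (hM.isIndec hij).1 <| by
    rw [IsZero.iff_id_eq_zero, ← IsIso.hom_inv_id f, h0, comp_zero]
  have h3 := (hM.exists_hom_iff hij hkl).1 ⟨f, h1⟩
  have h4 := (hM.exists_hom_iff hkl hij).1 ⟨inv f, h2⟩
  unfold IntervalHom at h3 h4
  omega

end TypeAData

/-- A finite biproduct over `Fin (m + 1)` splits off its first summand. -/
noncomputable def biproductFinSuccIso {m : ℕ} (f : Fin (m + 1) → C) :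
    (⨁ f) ≅ f 0 ⊞ ⨁ (fun i : Fin m => f i.succ) where
  hom := biprod.lift (biproduct.π f 0) (biproduct.lift fun i => biproduct.π f i.succ)
  inv := biprod.desc (biproduct.ι f 0) (biproduct.desc fun i => biproduct.ι f i.succ)
  hom_inv_id := by
    rw [biprod.lift_desc, biproduct.lift_desc, ← biproduct.total, Fin.sum_univ_succ]
  inv_hom_id := by
    apply biprod.hom_ext' <;> apply biprod.hom_ext
    · simp
    · apply biproduct.hom_ext
      intro i
      simp [biproduct.ι_π_ne _ (Fin.succ_ne_zero i).symm]
    · apply biproduct.hom_ext'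
      intro i
      simp [biproduct.ι_π_ne _ (Fin.succ_ne_zero i)]
    · apply biproduct.hom_ext'
      intro i
      apply biproduct.hom_ext
      intro k
      by_cases hik : i = k
      · subst hik
        simp
      · simp [biproduct.ι_π_ne _ hik, biproduct.ι_π_ne _ (fun h => hik (Fin.succ_injective _ h))]

namespace StabilityCondition

lemma mem_of_isZero (σ : StabilityCondition C) {φ : ℝ} {X Y : C} (hX : X ∈ σ.P φ)
    (hY : IsZero Y) : Y ∈ σ.P φ :=
  σ.summand_mem (σ.mem_of_iso (isoZeroBiprod hY) hX)

lemma biproduct_mem (σ : StabilityCondition C) {φ : ℝ} {X : C} (hX : X ∈ σ.P φ) (m : ℕ)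
    (f : Fin m → C) (hf : ∀ i, f i ∈ σ.P φ) : (⨁ f) ∈ σ.P φ := by
  induction m with
  | zero =>
    refine σ.mem_of_isZero hX ?_
    rw [IsZero.iff_id_eq_zero]
    exact biproduct.hom_ext _ _ fun i => i.elim0
  | succ m ih =>
    exact σ.mem_of_iso (biproductFinSuccIso f).symm
      (σ.sum_mem (hf 0) (ih _ fun i => hf i.succ))

/-- An object all of whose interval summands lie in a nonempty slice lies in that slice. -/
lemma mem_of_retracts (σ : StabilityCondition C) {n : ℕ} {M : ℕ → ℕ → C}
    (hM : TypeAData (C := C) n M) (hKS : KrullSchmidt (C := C)) {φ : ℝ} {X K : C}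
    (hX : X ∈ σ.P φ)
    (hK : ∀ (a b : ℕ) (m : ℤ), IsInterval n a b → Retract ((M a b)⟦m⟧) K → (M a b)⟦m⟧ ∈ σ.P φ) :
    K ∈ σ.P φ := by
  by_cases h0 : IsZero K
  · exact σ.mem_of_isZero hX h0
  obtain ⟨r, f, hf, ⟨e⟩⟩ := hKS K h0
  refine σ.mem_of_iso e.symm (σ.biproduct_mem hX r f fun i => ?_)
  obtain ⟨a, b, m, h1, h2, h3, ⟨e'⟩⟩ := (hM.indec_iff _).1 (hf i)
  have R : Retract (f i) (⨁ f) := ⟨biproduct.ι f i, biproduct.π f i, by simp⟩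
  exact σ.mem_of_iso e'.symm (hK a b m ⟨h1, h2, h3⟩
    (((Retract.ofIso e'.symm).trans R).trans (Retract.ofIso e.symm)))

lemma phase_le (σ : StabilityCondition C) {φ₁ φ₂ : ℝ} {E F : C} (hE : E ∈ σ.P φ₁)
    (hF : F ∈ σ.P φ₂) (h : ∃ f : E ⟶ F, f ≠ 0) : φ₁ ≤ φ₂ := by
  obtain ⟨f, hf⟩ := h
  by_contra! hlt
  exact hf (σ.hom_zero hlt hE hF f)

end StabilityCondition

lemma cross2_exp (r s α β : ℝ) :
    cross2 ((r : ℂ) * Complex.exp (Real.pi * α * Complex.I))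
      ((s : ℂ) * Complex.exp (Real.pi * β * Complex.I)) =
      r * s * Real.sin (Real.pi * (β - α)) := by
  have h : ∀ t : ℝ, Complex.exp (Real.pi * t * Complex.I) =
      (Real.cos (Real.pi * t) : ℂ) + (Real.sin (Real.pi * t) : ℂ) * Complex.I := by
    intro t
    rw [Complex.exp_mul_I]
    push_cast
    rfl
  rw [h, h, mul_sub, Real.sin_sub]
  simp only [cross2, Complex.add_re, Complex.add_im, Complex.ofReal_re, Complex.ofReal_im, Complex.mul_re, Complex.mul_im,
    Complex.I_re, Complex.I_im]
  ring

lemma eq_zero_or_eq_one_of_sin_pi_mul_eq_zero {x : ℝ} (h0 : 0 ≤ x) (h1 : x ≤ 1)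
    (h : Real.sin (Real.pi * x) = 0) : x = 0 ∨ x = 1 := by
  by_contra! hc
  have h2 : 0 < x := lt_of_le_of_ne h0 hc.1.symm
  have h3 : x < 1 := lt_of_le_of_ne h1 hc.2
  have := Real.sin_pos_of_pos_of_lt_pi (x := Real.pi * x) (by positivity)
    (by nlinarith [Real.pi_pos])
  exact this.ne' h

/-- For a totally stable stability condition, the phases of the two ends of the extension
`M i j ⟶ M i l ⟶ M (j + 1) l` differ by an amount strictly between `0` and `1`, so that their
central charges form a positively oriented pair. -/
lemma cross2_pos_of_totallyStable {n : ℕ} {M : ℕ → ℕ → C} (hM : TypeAData (C := C) n M)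
    (hKS : KrullSchmidt (C := C)) (σ : StabilityCondition C)
    (htot : ∀ E : C, IsIndec E → ∃ φ : ℝ, σ.IsStableOfPhase E φ) {i j l : ℕ}
    (hi : 1 ≤ i) (hij : i ≤ j) (hjl : j < l) (hl : l ≤ n)
    (hZ : σ.Z (M i l) = σ.Z (M i j) + σ.Z (M (j + 1) l)) :
    0 < cross2 (σ.Z (M i j)) (σ.Z (M (j + 1) l)) := by
  have vA : IsInterval n i j := by unfold IsInterval; omega
  have vB : IsInterval n i l := by unfold IsInterval; omega
  have vD : IsInterval n (j + 1) l := by unfold IsInterval; omega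
  obtain ⟨α, hA, hA0, hAs⟩ := htot _ (hM.isIndec vA)
  obtain ⟨β, hB, hB0, hBs⟩ := htot _ (hM.isIndec vB)
  obtain ⟨γ, hD, hD0, hDs⟩ := htot _ (hM.isIndec vD)
  have hA1 := (σ.shift_mem α _).1 hA
  have homAB := (hM.exists_hom_iff vA vB).2 (by unfold IntervalHom; omega)
  have homBD := (hM.exists_hom_iff vB vD).2 (by unfold IntervalHom; omega)
  have hαβ : α ≤ β := σ.phase_le hA hB homAB
  have hβγ : β ≤ γ := σ.phase_le hB hD homBD
  have hγα : γ ≤ α + 1 := σ.phase_le hD hA1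
    ((hM.exists_ext_iff vD vA).2 (by unfold IntervalExt; omega))
  obtain ⟨a, ha, hZA⟩ := σ.charge hA hA0
  obtain ⟨b, hb, hZB⟩ := σ.charge hB hB0
  obtain ⟨d, hd, hZD⟩ := σ.charge hD hD0
  obtain ⟨f, hf⟩ := homAB
  obtain ⟨K, g, h, hT⟩ := distinguished_cocone_triangle f
  have hK0 : ¬ IsZero K := fun h0 => hM.not_isIso vA vB (by omega) f
    ((Triangle.isZero₃_iff_isIso₁ _ hT).1 h0)
  have hK : K ∈ σ.P γ := σ.mem_of_retracts hM hKS hD fun c e m hce R => by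
    obtain ⟨rfl, rfl, rfl⟩ := hM.cone_retract_inclusion hi hij hjl hl hce hT hf R
    exact σ.mem_of_iso ((shiftFunctorZero C ℤ).app _).symm hD
  have hαγ : α < γ := by
    refine lt_of_le_of_ne (hαβ.trans hβγ) fun he => ?_
    have hβ : α = β := by linarith
    subst he hβ
    exact hBs _ _ f g h hT hA hK hA0 hK0
  have hγα' : γ < α + 1 := by
    refine lt_of_le_of_ne hγα fun he => ?_
    subst he
    have hs : a * b * Real.sin (Real.pi * (β - α)) = a * d * Real.sin (Real.pi * (α + 1 - α)) := by
      rw [← cross2_exp, ← cross2_exp, ← hZA, ← hZB, ← hZD, hZ]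
      simp only [cross2, Complex.add_re, Complex.add_im]
      ring
    rw [add_sub_cancel_left, mul_one, Real.sin_pi, mul_zero] at hs
    have hs' : Real.sin (Real.pi * (β - α)) = 0 :=
      (mul_eq_zero.1 hs).resolve_left (mul_pos ha hb).ne'
    rcases eq_zero_or_eq_one_of_sin_pi_mul_eq_zero (by linarith) (by linarith) hs' with hβ | hβ
    · obtain rfl : β = α := by linarith
      have hK' : K⟦(-1 : ℤ)⟧ ∈ σ.P β :=
        (σ.shift_mem _ _).2 (σ.mem_of_iso (shiftNegShift K (1 : ℤ)).symm hK)
      refine hAs _ _ _ _ _ (inv_rot_of_distTriang _ hT) hK' hB (fun h0 => hK0 ?_) hB0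
      exact ((shiftFunctor C (1 : ℤ)).map_isZero h0).of_iso (shiftNegShift K (1 : ℤ)).symm
    · obtain rfl : β = α + 1 := by linarith
      obtain ⟨f', hf'⟩ := homBD
      obtain ⟨K', g', h', hT'⟩ := distinguished_cocone_triangle f'
      have hK0' : ¬ IsZero K' := fun h0 => hM.not_isIso vB vD (by omega) f'
        ((Triangle.isZero₃_iff_isIso₁ _ hT').1 h0)
      have hK' : K' ∈ σ.P (α + 1) := σ.mem_of_retracts hM hKS hD fun c e m hce R => by
        obtain ⟨rfl, rfl, rfl⟩ := hM.cone_retract_projection hi hij hjl hl hce hT' hf' R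
        exact hA1
      exact hDs _ _ f' g' h' hT' hB hK' hB0 hK0'
  rw [hZA, hZD, cross2_exp]
  have := Real.sin_pos_of_pos_of_lt_pi (x := Real.pi * (γ - α))
    (mul_pos Real.pi_pos (by linarith)) (by nlinarith [Real.pi_pos])
  positivity

lemma sum_Icc_eq_vertexPt_sub (σ : StabilityCondition C) (M : ℕ → ℕ → C) {i j : ℕ}
    (hi : 1 ≤ i) (hij : i ≤ j) :
    ∑ k ∈ Finset.Icc i j, σ.Z (M k k) = vertexPt σ M j - vertexPt σ M (i - 1) := by
  obtain ⟨p, rfl⟩ : ∃ p, i = p + 1 := ⟨i - 1, by omega⟩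
  have h : ∀ a b : ℕ, Finset.Icc (a + 1) b = Finset.Ioc a b := fun a b => by
    ext x
    simp only [Finset.mem_Icc, Finset.mem_Ioc]
    omega
  have h0 : ∀ b : ℕ, Finset.Icc 1 b = Finset.Ioc 0 b := h 0
  rw [vertexPt, vertexPt, h, h0, h0, eq_sub_iff_add_eq', Nat.add_sub_cancel]
  exact Finset.sum_Ioc_consecutive _ (Nat.zero_le p) (by omega)

/-- A totally stable stability condition on `D^b(k A_n)` (with `Z(S₁) = 1`) gives rise,
via `P_j = Z(M_{1j})`, `P_0 = 0`, to a convex `(n+1)`-gon with vertices in anticlockwise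
order, such that `Z(M_{ij})` is the vector from `P_{i-1}` to `P_j`. -/
theorem totally_stable_gives_convex_polygon (n : ℕ) (hn : 1 ≤ n)
    (M : ℕ → ℕ → C) (hM : TypeAData (C := C) n M)
    (hKS : KrullSchmidt (C := C))
    (σ : StabilityCondition C)
    (hZadd : ∀ i j : ℕ, 1 ≤ i → i ≤ j → j ≤ n →
      σ.Z (M i j) = ∑ k ∈ Finset.Icc i j, σ.Z (M k k))
    (hnorm : σ.Z (M 1 1) = 1)
    (htot : ∀ E : C, IsIndec E → ∃ φ : ℝ, σ.IsStableOfPhase E φ) :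
    (∀ i j : ℕ, 1 ≤ i → i ≤ j → j ≤ n →
        σ.Z (M i j) = vertexPt σ M j - vertexPt σ M (i - 1)) ∧
      ConvexGonCCW (vertexPt σ M) n := by
  have hV : ∀ i j : ℕ, 1 ≤ i → i ≤ j → j ≤ n →
      σ.Z (M i j) = vertexPt σ M j - vertexPt σ M (i - 1) := fun i j hi hij hj => by
    rw [hZadd i j hi hij hj, sum_Icc_eq_vertexPt_sub σ M hi hij]
  refine ⟨hV, ?_⟩
  have key : ∀ p q r : ℕ, p < q → q < r → r ≤ n →
      0 < cross2 (vertexPt σ M q - vertexPt σ M p) (vertexPt σ M r - vertexPt σ M q) := by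
    intro p q r hpq hqr hr
    have h1 := hV (p + 1) q (by omega) (by omega) (by omega)
    have h2 := hV (q + 1) r (by omega) (by omega) (by omega)
    have h3 := hV (p + 1) r (by omega) (by omega) (by omega)
    simp only [Nat.add_sub_cancel] at h1 h2 h3
    rw [← h1, ← h2]
    refine cross2_pos_of_totallyStable hM hKS σ htot (by omega) (by omega) hqr hr ?_
    rw [h1, h2, h3]
    ring
  intro a b ha hb hba hba'
  rcases Nat.lt_or_ge a n with han | han
  · rw [Nat.mod_eq_of_lt (by omega)] at hba' ⊢
    rcases Nat.lt_or_ge b a with hlt | hge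
    · have := key b a (a + 1) hlt (by omega) (by omega)
      simp only [cross2, Complex.sub_re, Complex.sub_im] at this ⊢
      linarith
    · have := key a (a + 1) b (by omega) (by omega) hb
      simp only [cross2, Complex.sub_re, Complex.sub_im] at this ⊢
      linarith
  · obtain rfl : a = n := by omega
    rw [Nat.mod_self] at hba' ⊢
    have := key 0 b a (by omega) (by omega) le_rfl
    simp only [cross2, Complex.sub_re, Complex.sub_im] at this ⊢
    linarith
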